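/- Boolean infinite divisibility of all probability measures: for every Borel probability measure μ on ℝ and every integer n ≥ 1 there exists a Borel probability measure ν on ℝ such that B_μ(z) = n·B_ν(z) for all z ∈ ℍ; that is, every probability measure on ℝ is infinitely divisible with respect to the Boolean convolution. -/

import Mathlib

open MeasureTheory Filter Topology Set

/-- The Cauchy transform of a measure on ℝ, `G_μ(z) = ∫ 1/(z-x) dμ(x)`. -/
noncomputable def cauchyTransform (μ : Measure ℝ) (z : ℂ) : ℂ :=
  ∫ x, (z - (x : ℂ))⁻¹ ∂μ

/-- The F-transform of a measure on ℝ, `F_μ(z) = 1/G_μ(z)`. -/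
noncomputable def Ftransform (μ : Measure ℝ) (z : ℂ) : ℂ :=
  (cauchyTransform μ z)⁻¹

/-- The B-transform of a measure on ℝ, `B_μ(z) = z - F_μ(z)`. -/
noncomputable def Btransform (μ : Measure ℝ) (z : ℂ) : ℂ :=
  z - Ftransform μ z

open scoped InnerProductSpace

/-! ### Elementary bounds on the Cauchy transform -/

lemma sub_ofReal_ne_zero {z : ℂ} (hz : 0 < z.im) (x : ℝ) : z - (x : ℂ) ≠ 0 := by
  intro h
  have := congrArg Complex.im h
  simp at this
  exact hz.ne' this

lemma norm_inv_sub_ofReal_le {z : ℂ} (hz : 0 < z.im) (x : ℝ) :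
    ‖(z - (x : ℂ))⁻¹‖ ≤ z.im⁻¹ := by
  rw [norm_inv]
  gcongr
  simpa [abs_of_pos hz] using Complex.abs_im_le_norm (z - (x : ℂ))

lemma continuous_inv_sub_ofReal {z : ℂ} (hz : 0 < z.im) :
    Continuous fun x : ℝ ↦ (z - (x : ℂ))⁻¹ :=
  (continuous_const.sub Complex.continuous_ofReal).inv₀ (sub_ofReal_ne_zero hz)

lemma integrable_inv_sub_ofReal (μ : Measure ℝ) [IsFiniteMeasure μ] {z : ℂ} (hz : 0 < z.im) :
    Integrable (fun x : ℝ ↦ (z - (x : ℂ))⁻¹) μ :=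
  Integrable.of_bound (continuous_inv_sub_ofReal hz).aestronglyMeasurable z.im⁻¹
    (Eventually.of_forall (norm_inv_sub_ofReal_le hz))

lemma cauchyTransform_im_neg (μ : Measure ℝ) [IsProbabilityMeasure μ] {z : ℂ} (hz : 0 < z.im) :
    (cauchyTransform μ z).im < 0 := by
  have hint := integrable_inv_sub_ofReal μ hz
  have him : (cauchyTransform μ z).im = ∫ x : ℝ, ((z - (x : ℂ))⁻¹).im ∂μ :=
    (integral_im hint).symm
  have hpt : ∀ x : ℝ, 0 < -((z - (x : ℂ))⁻¹).im := fun x ↦ by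
    have h : 0 < Complex.normSq (z - (x : ℂ)) := Complex.normSq_pos.2 (sub_ofReal_ne_zero hz x)
    have : -((z - (x : ℂ))⁻¹).im = z.im / Complex.normSq (z - (x : ℂ)) := by
      simp [Complex.inv_im, neg_div]
    rw [this]
    positivity
  have hpos : 0 < ∫ x : ℝ, -((z - (x : ℂ))⁻¹).im ∂μ := by
    rw [integral_pos_iff_support_of_nonneg (fun x ↦ (hpt x).le) hint.im.neg]
    have : Function.support (fun x : ℝ ↦ -((z - (x : ℂ))⁻¹).im) = univ :=
      eq_univ_of_forall fun x ↦ (hpt x).ne'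
    rw [this]
    simp
  rw [integral_neg] at hpos
  linarith

/-- The mass of `μ` far away from the origin is controlled by its Cauchy transform on the
imaginary axis. -/
lemma measureReal_norm_gt_le (μ : Measure ℝ) [IsProbabilityMeasure μ] {y : ℝ} (hy : 0 < y) :
    μ.real {x | y < ‖x‖} ≤ 2 * ‖1 - (y * Complex.I) * cauchyTransform μ (y * Complex.I)‖ := by
  have hz : 0 < ((y : ℂ) * Complex.I).im := by simpa using hy
  have hint := integrable_inv_sub_ofReal μ hz
  have hint' : Integrable
      (fun x : ℝ ↦ 1 - (y * Complex.I) * ((y : ℂ) * Complex.I - (x : ℂ))⁻¹) μ :=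
    (integrable_const _).sub (hint.const_mul _)
  have hG : 1 - (y * Complex.I) * cauchyTransform μ (y * Complex.I) =
      ∫ x : ℝ, (1 - (y * Complex.I) * ((y : ℂ) * Complex.I - (x : ℂ))⁻¹) ∂μ := by
    rw [integral_sub (integrable_const _) (hint.const_mul _), integral_const_mul]
    simp [cauchyTransform]
  have hre : ∀ x : ℝ, (1 - (y * Complex.I) * ((y : ℂ) * Complex.I - (x : ℂ))⁻¹).re =
      x ^ 2 / (x ^ 2 + y ^ 2) := fun x ↦ by
    have : x ^ 2 + y ^ 2 ≠ 0 := by positivity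
    simp [Complex.inv_im, Complex.normSq_apply]
    field_simp
    ring
  have hm : MeasurableSet {x : ℝ | y < ‖x‖} := measurableSet_lt measurable_const measurable_norm
  calc μ.real {x | y < ‖x‖} = ∫ x, {x : ℝ | y < ‖x‖}.indicator (fun _ ↦ (1 : ℝ)) x ∂μ := by
        rw [integral_indicator_const _ hm, smul_eq_mul, mul_one]
    _ ≤ ∫ x : ℝ, 2 * (1 - (y * Complex.I) * ((y : ℂ) * Complex.I - (x : ℂ))⁻¹).re ∂μ := by
        refine integral_mono ((integrable_const _).indicator hm) (hint'.re.const_mul 2) fun x ↦ ?_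
        simp only [hre]
        by_cases hx : y < ‖x‖
        · rw [indicator_of_mem (by exact hx), ← mul_div_assoc, le_div_iff₀ (by positivity)]
          have : y ^ 2 < x ^ 2 := sq_lt_sq.2 (by rwa [abs_of_pos hy])
          linarith
        · rw [indicator_of_notMem (by exact hx)]
          positivity
    _ = 2 * (1 - (y * Complex.I) * cauchyTransform μ (y * Complex.I)).re := by
        rw [integral_const_mul, hG]
        congr 1
        exact integral_re hint'
    _ ≤ _ := by
        gcongr
        exact Complex.re_le_norm _

lemma tendsto_mul_cauchyTransform (μ : Measure ℝ) [IsProbabilityMeasure μ] :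
    Tendsto (fun y : ℝ ↦ (y * Complex.I) * cauchyTransform μ (y * Complex.I)) atTop (𝓝 1) := by
  have h1 : (1 : ℂ) = ∫ _ : ℝ, (1 : ℂ) ∂μ := by simp
  simp only [cauchyTransform, ← integral_const_mul]
  rw [h1]
  refine tendsto_integral_filter_of_dominated_convergence (fun _ ↦ 1) ?_ ?_
    (integrable_const _) ?_
  · filter_upwards [eventually_gt_atTop 0] with y hy
    have hz : 0 < ((y : ℂ) * Complex.I).im := by simpa using hy
    exact (continuous_const.mul (continuous_inv_sub_ofReal hz)).aestronglyMeasurable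
  · filter_upwards [eventually_gt_atTop 0] with y hy
    have hz : 0 < ((y : ℂ) * Complex.I).im := by simpa using hy
    refine Eventually.of_forall fun x ↦ ?_
    have h := norm_inv_sub_ofReal_le hz x
    rw [norm_mul]
    calc _ ≤ ‖(y : ℂ) * Complex.I‖ * ((y : ℂ) * Complex.I).im⁻¹ := by gcongr
      _ = 1 := by simp [abs_of_pos hy, hy.ne']
  · refine Eventually.of_forall fun x ↦ ?_
    have hlim : Tendsto (fun y : ℝ ↦ (x : ℂ) * ((y : ℂ) * Complex.I - x)⁻¹) atTop (𝓝 0) := by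
      have : Tendsto (fun y : ℝ ↦ |x| * y⁻¹) atTop (𝓝 0) := by
        simpa using tendsto_inv_atTop_zero.const_mul |x|
      refine squeeze_zero_norm' ?_ this
      filter_upwards [eventually_gt_atTop 0] with y hy
      have hz : 0 < ((y : ℂ) * Complex.I).im := by simpa using hy
      have h := norm_inv_sub_ofReal_le hz x
      rw [norm_mul, Complex.norm_real, Real.norm_eq_abs]
      gcongr
      simpa using h
    have : Tendsto (fun y : ℝ ↦ 1 + (x : ℂ) * ((y : ℂ) * Complex.I - x)⁻¹) atTop (𝓝 1) := by
      simpa using hlim.const_add 1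
    refine this.congr' ?_
    filter_upwards [eventually_gt_atTop 0] with y hy
    have hz : 0 < ((y : ℂ) * Complex.I).im := by simpa using hy
    have h := sub_ofReal_ne_zero hz x
    field_simp
    ring

/-! ### Limits of Cauchy transforms -/

/-- A pointwise limit of Cauchy transforms of probability measures which is asymptotic to `1 / z`
along the imaginary axis is the Cauchy transform of a probability measure. -/
lemma exists_cauchyTransform_eq_of_tendsto (ν : ℕ → Measure ℝ)
    [∀ k, IsProbabilityMeasure (ν k)] (g : ℂ → ℂ)
    (hlim : ∀ z : ℂ, 0 < z.im → Tendsto (fun k ↦ cauchyTransform (ν k) z) atTop (𝓝 (g z)))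
    (hg : Tendsto (fun y : ℝ ↦ (y * Complex.I) * g (y * Complex.I)) atTop (𝓝 1)) :
    ∃ ρ : Measure ℝ, IsProbabilityMeasure ρ ∧ ∀ z : ℂ, 0 < z.im → cauchyTransform ρ z = g z := by
  have htight : IsTightMeasureSet (Set.range ν) := by
    refine isTightMeasureSet_range_of_tendsto_limsup_measure_norm_gt ?_
    have hbound : Tendsto (fun y : ℝ ↦ ENNReal.ofReal
        (2 * ‖1 - (y * Complex.I) * g (y * Complex.I)‖)) atTop (𝓝 0) := by
      have := ENNReal.tendsto_ofReal ((hg.const_sub 1).norm.const_mul 2)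
      simpa using this
    refine tendsto_of_tendsto_of_tendsto_of_le_of_le' tendsto_const_nhds hbound
      (Eventually.of_forall fun _ ↦ zero_le) ?_
    filter_upwards [eventually_gt_atTop 0] with y hy
    have hz : 0 < ((y : ℂ) * Complex.I).im := by simpa using hy
    have hk := ENNReal.tendsto_ofReal
      ((((hlim _ hz).const_mul (y * Complex.I)).const_sub 1).norm.const_mul 2)
    rw [← hk.limsup_eq]
    refine limsup_le_limsup (Eventually.of_forall fun k ↦ ?_)
    have := measureReal_norm_gt_le (ν k) hy
    exact (ofReal_measureReal (measure_ne_top (ν k) _)).symm.trans_le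
      (ENNReal.ofReal_le_ofReal this)
  let P : ℕ → ProbabilityMeasure ℝ := fun k ↦ ⟨ν k, inferInstance⟩
  have hcomp : IsCompact (closure (Set.range P)) := by
    refine isCompact_closure_of_isTightMeasureSet (htight.subset ?_)
    rintro _ ⟨_, ⟨k, rfl⟩, rfl⟩
    exact ⟨k, rfl⟩
  obtain ⟨ρ, -, hρ⟩ := hcomp.ultrafilter_le_nhds ((Ultrafilter.of (atTop : Filter ℕ)).map P) (by
    rw [le_principal_iff]
    exact mem_of_superset (Ultrafilter.mem_map.2 (univ_mem' mem_range_self)) subset_closure)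
  refine ⟨ρ, inferInstance, fun z hz ↦ ?_⟩
  have hint := (ProbabilityMeasure.tendsto_iff_forall_integral_rclike_tendsto ℂ).1
    (show Tendsto P (Ultrafilter.of (atTop : Filter ℕ)) (𝓝 ρ) from hρ)
    (BoundedContinuousFunction.ofNormedAddCommGroup _ (continuous_inv_sub_ofReal hz) z.im⁻¹
      (norm_inv_sub_ofReal_le hz))
  exact tendsto_nhds_unique hint ((hlim z hz).mono_left (Ultrafilter.of_le _))

/-! ### Finitely supported measures -/

section Symmetric

variable {E : Type*} [NormedAddCommGroup E] [InnerProductSpace ℂ E] [FiniteDimensional ℂ E]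

/-- The spectral measure of a symmetric operator in a unit vector state. -/
lemma exists_cauchyTransform_eq_inner {T : E →ₗ[ℂ] E} (hT : T.IsSymmetric) {ξ : E}
    (hξ : ‖ξ‖ = 1) :
    ∃ ν : Measure ℝ, IsProbabilityMeasure ν ∧ ∀ z : ℂ, 0 < z.im → ∀ (v : E) (c : ℂ),
      z • v - T v = c • ξ → c * cauchyTransform ν z = ⟪ξ, v⟫_ℂ := by
  let b := hT.eigenvectorBasis rfl
  let ev := hT.eigenvalues rfl
  refine ⟨∑ i, ENNReal.ofReal (‖⟪b i, ξ⟫_ℂ‖ ^ 2) • Measure.dirac (ev i), ⟨?_⟩, ?_⟩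
  · simp only [Measure.coe_finsetSum, Finset.sum_apply, Measure.smul_apply, measure_univ,
      smul_eq_mul, mul_one]
    rw [← ENNReal.ofReal_sum_of_nonneg (fun _ _ ↦ by positivity), b.sum_sq_norm_inner_right, hξ]
    simp
  · intro z hz v c h
    have hG : cauchyTransform (∑ i, ENNReal.ofReal (‖⟪b i, ξ⟫_ℂ‖ ^ 2) • Measure.dirac (ev i)) z =
        ∑ i, ((‖⟪b i, ξ⟫_ℂ‖ ^ 2 : ℝ) : ℂ) * (z - (ev i : ℂ))⁻¹ := by
      rw [cauchyTransform, integral_finsetSum_measure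
        fun i _ ↦ (integrable_inv_sub_ofReal _ hz).smul_measure ENNReal.ofReal_ne_top]
      refine Finset.sum_congr rfl fun i _ ↦ ?_
      rw [integral_smul_measure, integral_dirac, ENNReal.toReal_ofReal (by positivity),
        Complex.real_smul]
    rw [hG, ← b.sum_inner_mul_inner ξ v, Finset.mul_sum]
    refine Finset.sum_congr rfl fun i _ ↦ ?_
    have hi : (z - (ev i : ℂ)) * ⟪b i, v⟫_ℂ = c * ⟪b i, ξ⟫_ℂ := by
      rw [← inner_smul_right _ _ c, ← h, inner_sub_right, inner_smul_right, ← hT (b i) v,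
        hT.apply_eigenvectorBasis rfl i, inner_smul_left, RCLike.conj_ofReal,
        sub_mul]
      rfl
    have hne := sub_ofReal_ne_zero hz (ev i)
    have hsq : ((‖⟪b i, ξ⟫_ℂ‖ ^ 2 : ℝ) : ℂ) = ⟪ξ, b i⟫_ℂ * ⟪b i, ξ⟫_ℂ := by
      rw [← inner_conj_symm ξ (b i), mul_comm, Complex.mul_conj, Complex.normSq_eq_norm_sq]
    rw [hsq]
    field_simp
    linear_combination (-⟪ξ, b i⟫_ℂ) * hi

/-- If `P` is the projection onto the unit vector `ξ` and `S = 1 - P + t^{-1/2} P`, then the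
spectral measure of `S X S` is the Boolean convolution power of exponent `1 / t` of the spectral
measure of `X`. -/
lemma exists_cauchyTransform_compression {X : E →ₗ[ℂ] E} (hX : X.IsSymmetric) {ξ : E}
    (hξ : ‖ξ‖ = 1) {t : ℝ} (ht : 0 < t) :
    ∃ ν : Measure ℝ, IsProbabilityMeasure ν ∧ ∀ z : ℂ, 0 < z.im → ∀ u : E, z • u - X u = ξ →
      (1 + (t - 1) * z * ⟪ξ, u⟫_ℂ) * cauchyTransform ν z = t * ⟪ξ, u⟫_ℂ := by
  set s : ℝ := √t
  have hs : 0 < s := Real.sqrt_pos.2 ht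
  have hst : (t : ℂ) = s * s := by
    rw [← Complex.ofReal_mul, Real.mul_self_sqrt ht.le]
  have hs0 : (s : ℂ) ≠ 0 := Complex.ofReal_ne_zero.2 hs.ne'
  have hξξ : ⟪ξ, ξ⟫_ℂ = 1 := by simp [inner_self_eq_norm_sq_to_K, hξ]
  let S : E →ₗ[ℂ] E :=
    LinearMap.id + (((s⁻¹ - 1 : ℝ) : ℂ)) • ((innerSL ℂ ξ : E →ₗ[ℂ] ℂ).smulRight ξ)
  have hS_apply : ∀ v, S v = v + (((s⁻¹ - 1 : ℝ) : ℂ) * ⟪ξ, v⟫_ℂ) • ξ := fun v ↦ by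
    simp [S, mul_smul]
  have hS : S.IsSymmetric := fun v w ↦ by
    rw [hS_apply, hS_apply, inner_add_left, inner_add_right, inner_smul_left, inner_smul_right,
      map_mul, Complex.conj_ofReal, inner_conj_symm]
    ring
  have hT : (S ∘ₗ X ∘ₗ S).IsSymmetric := fun v w ↦ by
    simp only [LinearMap.comp_apply]
    rw [hS, hX, hS]
  obtain ⟨ν, hν, h⟩ := exists_cauchyTransform_eq_inner hT hξ
  refine ⟨ν, hν, fun z hz u hu ↦ ?_⟩
  have hXu : X u = z • u - ξ := by rw [← hu]; abel
  have hSv : S (u + ((s - 1) * ⟪ξ, u⟫_ℂ) • ξ) = u := by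
    rw [hS_apply, inner_add_right, inner_smul_right, hξξ, add_assoc, ← add_smul]
    convert add_zero u
    convert zero_smul ℂ ξ
    push_cast
    field_simp
    ring
  have key := h z hz (u + ((s - 1) * ⟪ξ, u⟫_ℂ) • ξ) ((s : ℂ)⁻¹ * (1 + (t - 1) * z * ⟪ξ, u⟫_ℂ)) (by
    rw [LinearMap.comp_apply, LinearMap.comp_apply, hSv, hXu, hS_apply, inner_sub_right,
      inner_smul_right, hξξ, hst]
    match_scalars
    · ring
    · field_simp
      ring)
  rw [inner_add_right, inner_smul_right, hξξ] at key
  rw [hst] at key ⊢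
  field_simp at key
  linear_combination key

end Symmetric

lemma exists_cauchyTransform_simpleFunc (μ : Measure ℝ) [IsProbabilityMeasure μ]
    (f : SimpleFunc ℝ ℝ) {t : ℝ} (ht : 0 < t) :
    ∃ ν : Measure ℝ, IsProbabilityMeasure ν ∧ ∀ z : ℂ, 0 < z.im →
      (1 + (t - 1) * z * cauchyTransform (μ.map f) z) * cauchyTransform ν z =
        t * cauchyTransform (μ.map f) z := by
  classical
  let w : f.range → ℝ := fun y ↦ μ.real (f ⁻¹' {(y : ℝ)})
  have hw : ∀ y, 0 ≤ w y := fun y ↦ measureReal_nonneg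
  have hsum : ∀ φ : ℝ → ℂ, ∫ x, φ (f x) ∂μ = ∑ y : f.range, (w y : ℂ) * φ y := fun φ ↦ by
    have hφ : (fun x ↦ φ (f x)) = fun x ↦ ∑ y ∈ f.range, (f ⁻¹' {y}).indicator (fun _ ↦ φ y) x := by
      ext x
      rw [Finset.sum_eq_single_of_mem (f x) (f.mem_range_self x)]
      · simp
      · intro y _ hy
        exact indicator_of_notMem (fun h ↦ hy (by simpa using Eq.symm h)) _
    rw [hφ, integral_finsetSum _
      fun y _ ↦ (integrable_const (φ y)).indicator (f.measurableSet_fiber y)]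
    simp_rw [integral_indicator (f.measurableSet_fiber _), setIntegral_const, Complex.real_smul]
    exact (Finset.sum_coe_sort f.range fun y ↦ ((μ.real (f ⁻¹' {y}) : ℝ) : ℂ) * φ y).symm
  have hG : ∀ z, 0 < z.im →
      cauchyTransform (μ.map f) z = ∑ y : f.range, (w y : ℂ) * (z - ((y : ℝ) : ℂ))⁻¹ :=
    fun z hz ↦ by
      rw [cauchyTransform, integral_map f.measurable.aemeasurable
        (continuous_inv_sub_ofReal hz).aestronglyMeasurable]
      exact hsum fun y ↦ (z - (y : ℂ))⁻¹
  let ξ : EuclideanSpace ℂ f.range := WithLp.toLp 2 fun y ↦ (√(w y) : ℂ)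
  have hξ : ‖ξ‖ = 1 := by
    have h1 : ∑ y, w y = 1 := by
      have := hsum fun _ ↦ 1
      simp only [integral_const, probReal_univ, one_smul, mul_one] at this
      exact_mod_cast this.symm
    rw [EuclideanSpace.norm_eq, Real.sqrt_eq_one, ← h1]
    refine Finset.sum_congr rfl fun y _ ↦ ?_
    simp [ξ, Real.sq_sqrt (hw y)]
  let D : Matrix f.range f.range ℂ := Matrix.diagonal fun y ↦ ((y : ℝ) : ℂ)
  have hD : (Matrix.toEuclideanLin D).IsSymmetric := by
    rw [Matrix.isSymmetric_toEuclideanLin_iff]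
    refine Matrix.isHermitian_diagonal_of_self_adjoint _ ?_
    ext y
    simp
  obtain ⟨ν, hν, h⟩ := exists_cauchyTransform_compression hD hξ ht
  refine ⟨ν, hν, fun z hz ↦ ?_⟩
  let u : EuclideanSpace ℂ f.range :=
    WithLp.toLp 2 fun y ↦ (z - ((y : ℝ) : ℂ))⁻¹ * (√(w y) : ℂ)
  have hu : z • u - Matrix.toEuclideanLin D u = ξ := by
    ext y
    have hne := sub_ofReal_ne_zero hz (y : ℝ)
    simp [u, ξ, D, Matrix.mulVec_diagonal]
    field_simp
  have hinner : ⟪ξ, u⟫_ℂ = cauchyTransform (μ.map f) z := by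
    rw [hG z hz, PiLp.inner_apply]
    refine Finset.sum_congr rfl fun y _ ↦ ?_
    have : (w y : ℂ) = √(w y) * √(w y) := by
      rw [← Complex.ofReal_mul, Real.mul_self_sqrt (hw y)]
    simp only [u, ξ, RCLike.inner_apply, Complex.conj_ofReal, this]
    ring
  simpa only [hinner] using h z hz u hu

lemma exists_simpleFunc_tendsto_cauchyTransform (μ : Measure ℝ) [IsProbabilityMeasure μ] :
    ∃ f : ℕ → SimpleFunc ℝ ℝ, ∀ z : ℂ, 0 < z.im →
      Tendsto (fun k ↦ cauchyTransform (μ.map (f k)) z) atTop (𝓝 (cauchyTransform μ z)) := by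
  let f : ℕ → SimpleFunc ℝ ℝ := SimpleFunc.approxOn id measurable_id univ 0 (mem_univ 0)
  refine ⟨f, fun z hz ↦ ?_⟩
  have hcont := continuous_inv_sub_ofReal hz
  have hmap : ∀ k, cauchyTransform (μ.map (f k)) z = ∫ x, (z - ((f k x : ℝ) : ℂ))⁻¹ ∂μ :=
    fun k ↦ integral_map (f k).measurable.aemeasurable hcont.aestronglyMeasurable
  simp_rw [hmap]
  refine tendsto_integral_of_dominated_convergence (fun _ ↦ z.im⁻¹)
    (fun k ↦ (hcont.measurable.comp (f k).measurable).aestronglyMeasurable) (integrable_const _)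
    (fun k ↦ Eventually.of_forall fun x ↦ norm_inv_sub_ofReal_le hz _)
    (Eventually.of_forall fun x ↦ ?_)
  exact (hcont.tendsto x).comp
    (SimpleFunc.tendsto_approxOn measurable_id (mem_univ 0) (by simp))

/-- Every probability measure on ℝ is infinitely divisible with respect to the Boolean
convolution: for every `n ≥ 1` there is a probability measure ν with `B_μ = n·B_ν` on ℍ. -/
theorem boolean_infinitely_divisible
    (μ : Measure ℝ) [IsProbabilityMeasure μ] (n : ℕ) (hn : 1 ≤ n) :
    ∃ ν : Measure ℝ, IsProbabilityMeasure ν ∧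
      ∀ z : ℂ, 0 < z.im → Btransform μ z = (n : ℂ) * Btransform ν z := by
  have hn' : (1 : ℝ) ≤ n := by exact_mod_cast hn
  have hn0 : (n : ℂ) ≠ 0 := by exact_mod_cast (by lia : n ≠ 0)
  have hG0 : ∀ ρ : Measure ℝ, IsProbabilityMeasure ρ → ∀ z : ℂ, 0 < z.im →
      cauchyTransform ρ z ≠ 0 := fun ρ _ z hz h ↦ by
    simpa [h] using cauchyTransform_im_neg ρ hz
  have hden : ∀ z : ℂ, 0 < z.im → 1 + ((n : ℂ) - 1) * z * cauchyTransform μ z ≠ 0 := by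
    intro z hz h
    have hF : 0 < ((cauchyTransform μ z)⁻¹).im := by
      rw [Complex.inv_im]
      exact div_pos (neg_pos.2 (cauchyTransform_im_neg μ hz))
        (Complex.normSq_pos.2 (hG0 μ inferInstance z hz))
    have hsum : (cauchyTransform μ z)⁻¹ + ((n - 1 : ℝ) : ℂ) * z = 0 := by
      have := hG0 μ inferInstance z hz
      push_cast
      field_simp
      linear_combination h
    have him := congrArg Complex.im hsum
    rw [Complex.add_im, Complex.im_ofReal_mul, Complex.zero_im] at him
    nlinarith [mul_nonneg (sub_nonneg.2 hn') hz.le]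
  obtain ⟨f, hf⟩ := exists_simpleFunc_tendsto_cauchyTransform μ
  choose ν hν hνG using fun k ↦
    exists_cauchyTransform_simpleFunc μ (f k) (zero_lt_one.trans_le hn')
  simp only [Complex.ofReal_natCast] at hνG
  obtain ⟨ρ, hρ, hρG⟩ := exists_cauchyTransform_eq_of_tendsto ν
    (fun z ↦ n * cauchyTransform μ z / (1 + ((n : ℂ) - 1) * z * cauchyTransform μ z))
    (fun z hz ↦ by
      have hd := ((hf z hz).const_mul (((n : ℂ) - 1) * z)).const_add 1
      refine (((hf z hz).const_mul (n : ℂ)).div hd (hden z hz)).congr' ?_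
      filter_upwards [hd.eventually_ne (hden z hz)] with k hk
      exact (eq_div_of_mul_eq hk ((mul_comm _ _).trans (hνG k z hz))).symm)
    (by
      have h := tendsto_mul_cauchyTransform μ
      have hlim := (h.const_mul (n : ℂ)).div ((h.const_mul ((n : ℂ) - 1)).const_add 1)
        (by simpa using hn0)
      have hone : (n : ℂ) * 1 / (1 + ((n : ℂ) - 1) * 1) = 1 := by simp [hn0]
      rw [hone] at hlim
      refine hlim.congr fun y ↦ ?_
      simp only [Pi.div_apply]
      ring)
  refine ⟨ρ, hρ, fun z hz ↦ ?_⟩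
  have hμ0 := hG0 μ inferInstance z hz
  have hd := hden z hz
  simp only [Btransform, Ftransform, hρG z hz]
  field_simp
  ring
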